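/- arXiv:1902.08637 — 4 statements merged into one kernel-verified Lean document; each statement's English description precedes it below -/
import Mathlib

section
/- Let T be a one-parameter C₀-semigroup on a complex Banach space X with generator A and ‖T(t)‖ ≤ M (M ≥ 1) for all t ≥ 0. Then for every x ∈ D(A) with ‖x‖ = 1 and every u > 0, ‖(T(u) − I)x‖ ≤ K_M·(1 − e^{−‖Ax‖u}), where K_M = (M+1)/(1 − e^{−(M+1)/M}). -/
open MeasureTheory Filter Topology

noncomputable section

/-- A (one-parameter) `C₀`-semigroup of bounded operators on `X`. -/
def IsC0Semigroup {X : Type*} [NormedAddCommGroup X] [NormedSpace ℂ X]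
    (T : ℝ → X →L[ℂ] X) : Prop :=
  T 0 = 1 ∧ (∀ s t : ℝ, 0 ≤ s → 0 ≤ t → T (s + t) = T s ∘L T t) ∧
    ∀ x : X, Tendsto (fun t => T t x) (𝓝[≥] (0 : ℝ)) (𝓝 x)

/-- `InGenDomain T x y` means `x` belongs to the domain of the infinitesimal generator `A`
of the semigroup `T` and `A x = y`. -/
def InGenDomain {X : Type*} [NormedAddCommGroup X] [NormedSpace ℂ X]
    (T : ℝ → X →L[ℂ] X) (x y : X) : Prop :=
  Tendsto (fun t : ℝ => t⁻¹ • (T t x - x)) (𝓝[>] (0 : ℝ)) (𝓝 y)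

/-- The `n`-parameter semigroup `T(u) = T₁(u₁) ⋯ Tₙ(uₙ)`. -/
def Tprod {X : Type*} [NormedAddCommGroup X] [NormedSpace ℂ X] {n : ℕ}
    (T : Fin n → ℝ → X →L[ℂ] X) (u : Fin n → ℝ) : X →L[ℂ] X :=
  (List.ofFn fun j => T j (u j)).prod

/-- The open negative orthant `(-∞,0)ⁿ`. -/
def negOrthant (n : ℕ) : Set (Fin n → ℝ) := {s | ∀ j, s j < 0}

/-- The closed nonpositive orthant `(-∞,0]ⁿ`. -/
def nonposOrthant (n : ℕ) : Set (Fin n → ℝ) := {s | ∀ j, s j ≤ 0}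

/-- A function of `n` variables is absolutely monotone on `(-∞,0)ⁿ` if it is nonnegative
together with all its iterated partial derivatives there. -/
def AbsMonotoneOn (n : ℕ) (f : (Fin n → ℝ) → ℝ) : Prop :=
  ∀ (k : ℕ) (v : Fin k → Fin n) (s : Fin n → ℝ), s ∈ negOrthant n →
    0 ≤ iteratedFDerivWithin ℝ k f (negOrthant n) s (fun i => Pi.single (v i) 1)

/-- Membership in the class `𝒯ₙ` of (negative) Bernstein functions of `n` variables:
`ψ` is a nonpositive `C^∞`-function on `(-∞,0)ⁿ` all of whose first-order partial
derivatives are absolutely monotone. -/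
def MemTn (n : ℕ) (ψ : (Fin n → ℝ) → ℝ) : Prop :=
  ContDiffOn ℝ (⊤ : ℕ∞) ψ (negOrthant n) ∧ (∀ s ∈ negOrthant n, ψ s ≤ 0) ∧
    ∀ j : Fin n, AbsMonotoneOn n
      (fun s => fderivWithin ℝ ψ (negOrthant n) s (Pi.single j 1))

/-- The Lévy–Khintchine type representation
`ψ(s) = c₀ + c₁·s + ∫ (e^{s·u} - 1) dμ(u)` of a Bernstein function of `n` variables,
where `c₀ ≤ 0`, `c₁ ∈ ℝ₊ⁿ` and `μ` is a positive measure on `ℝ₊ⁿ \ {0}`. -/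
def HasLevyRep (n : ℕ) (ψ : (Fin n → ℝ) → ℝ) (c₀ : ℝ) (c₁ : Fin n → ℝ)
    (μ : Measure (Fin n → ℝ)) : Prop :=
  c₀ ≤ 0 ∧ (∀ j, 0 ≤ c₁ j) ∧ μ {u | ¬ ((∀ j, 0 ≤ u j) ∧ u ≠ 0)} = 0 ∧
    (∀ s ∈ negOrthant n, Integrable (fun u => Real.exp (∑ j, s j * u j) - 1) μ) ∧
    ∀ s ∈ negOrthant n, ψ s = c₀ + ∑ j, c₁ j * s j +
      ∫ u, (Real.exp (∑ j, s j * u j) - 1) ∂μ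

/-- The family of bounded positive measures `ν_t` on `ℝ₊ⁿ` with
`∫ e^{s·u} dν_t(u) = e^{t ψ(s)}` (multidimensional Bernstein–Widder). -/
def IsSubordinator (n : ℕ) (ψ : (Fin n → ℝ) → ℝ) (ν : ℝ → Measure (Fin n → ℝ)) : Prop :=
  ∀ t : ℝ, 0 ≤ t → IsFiniteMeasure (ν t) ∧ (ν t) {u | ¬ ∀ j, 0 ≤ u j} = 0 ∧
    ∀ s ∈ negOrthant n, ∫ u, Real.exp (∑ j, s j * u j) ∂(ν t) = Real.exp (t * ψ s)

/-- The holomorphic (complex) extension `ψ(λ) = c₀ + c₁·λ + ∫ (e^{λ·u} - 1) dμ(u)`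
of a Bernstein function with representation `(c₀, c₁, μ)` to `{Re λ ≤ 0} ⊆ ℂⁿ`. -/
def psiC (n : ℕ) (c₀ : ℝ) (c₁ : Fin n → ℝ) (μ : Measure (Fin n → ℝ))
    (l : Fin n → ℂ) : ℂ :=
  (c₀ : ℂ) + ∑ j, (c₁ j : ℂ) * l j +
    ∫ u, (Complex.exp (∑ j, l j * (u j : ℂ)) - 1) ∂μ

/-- The joint point spectrum of the tuple of generators of the semigroups `T j`. -/
def JointPointSpectrum {X : Type*} [NormedAddCommGroup X] [NormedSpace ℂ X] {n : ℕ}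
    (T : Fin n → ℝ → X →L[ℂ] X) : Set (Fin n → ℂ) :=
  {l | ∃ x : X, x ≠ 0 ∧ ∀ j, InGenDomain (T j) x (l j • x)}

/-- The joint approximate point spectrum of the tuple of generators of the `T j`. -/
def JointApproxSpectrum {X : Type*} [NormedAddCommGroup X] [NormedSpace ℂ X] {n : ℕ}
    (T : Fin n → ℝ → X →L[ℂ] X) : Set (Fin n → ℂ) :=
  {l | ∃ (x : ℕ → X) (y : Fin n → ℕ → X), (∀ m, ‖x m‖ = 1) ∧
    (∀ j m, InGenDomain (T j) (x m) (y j m)) ∧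
    ∀ j, Tendsto (fun m => ‖y j m - l j • x m‖) atTop (𝓝 0)}

/-- The joint residual spectrum of the tuple of generators of the `T j`:
those `λ ∈ ℂⁿ` for which `Σⱼ Im (λⱼ - Aⱼ)` is not dense in `X`. -/
def JointResidualSpectrum {X : Type*} [NormedAddCommGroup X] [NormedSpace ℂ X] {n : ℕ}
    (T : Fin n → ℝ → X →L[ℂ] X) : Set (Fin n → ℂ) :=
  {l | ¬ Dense (↑(Submodule.span ℂ
      (⋃ j, {z : X | ∃ x y, InGenDomain (T j) x y ∧ z = l j • x - y})) : Set X)}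

/-- The point spectrum of a (possibly unbounded) operator given by its graph
relation `R x y ↔ (x ∈ D(B) ∧ B x = y)`. -/
def PointSpec {X : Type*} [NormedAddCommGroup X] [NormedSpace ℂ X]
    (R : X → X → Prop) : Set ℂ :=
  {α | ∃ x : X, x ≠ 0 ∧ R x (α • x)}

/-- The approximate point spectrum of an operator given by its graph relation. -/
def ApproxSpec {X : Type*} [NormedAddCommGroup X] [NormedSpace ℂ X]
    (R : X → X → Prop) : Set ℂ :=
  {α | ∃ x y : ℕ → X, (∀ m, ‖x m‖ = 1) ∧ (∀ m, R (x m) (y m)) ∧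
    Tendsto (fun m => ‖y m - α • x m‖) atTop (𝓝 0)}

/-- The residual spectrum of an operator given by its graph relation:
those `α` for which `Im (α - B)` is not dense. -/
def ResidualSpec {X : Type*} [NormedAddCommGroup X] [NormedSpace ℂ X]
    (R : X → X → Prop) : Set ℂ :=
  {α | ¬ Dense (↑(Submodule.span ℂ {z : X | ∃ x y, R x y ∧ z = α • x - y}) : Set X)}

/-- The resolvent set of a closed operator given by its graph relation: `α` such that
`α - B : D(B) → X` has a bounded everywhere-defined inverse. -/
def ResolventSet {X : Type*} [NormedAddCommGroup X] [NormedSpace ℂ X]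
    (R : X → X → Prop) : Set ℂ :=
  {α | ∃ Rv : X →L[ℂ] X, (∀ z : X, R (Rv z) (α • Rv z - z)) ∧
    ∀ x y : X, R x y → Rv (α • x - y) = x}

/-- The constant `K_M = (M+1)/(1 - e^{-(M+1)/M})` from the moment inequality. -/
def KM (M : ℝ) : ℝ := (M + 1) / (1 - Real.exp (-(M + 1) / M))

/-- The open sector `{z ≠ 0 : |arg z| < θ}` in `ℂ`. -/
def Sector (θ : ℝ) : Set ℂ := {z | z ≠ 0 ∧ |Complex.arg z| < θ}

/-- A `C₀`-semigroup is holomorphic if it extends to a holomorphic semigroup on some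
open sector around the positive half axis, strongly continuous at `0` in the sector. -/
def IsHolomorphicSemigroup {X : Type*} [NormedAddCommGroup X] [NormedSpace ℂ X]
    (T : ℝ → X →L[ℂ] X) : Prop :=
  ∃ (θ : ℝ) (S : ℂ → X →L[ℂ] X), 0 < θ ∧ (∀ t : ℝ, 0 < t → S t = T t) ∧
    (∀ z w : ℂ, z ∈ Sector θ → w ∈ Sector θ → S (z + w) = S z ∘L S w) ∧
    DifferentiableOn ℂ S (Sector θ) ∧
    ∀ x : X, Tendsto (fun z => S z x) (𝓝[Sector θ] 0) (𝓝 x)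

end

theorem sdb_lip_aux
    {X : Type*} [NormedAddCommGroup X] [NormedSpace ℂ X]
    (T : ℝ → X →L[ℂ] X) (M : ℝ)
    (hT : IsC0Semigroup T) (hM : ∀ t, 0 ≤ t → ‖T t‖ ≤ M) (x : X) (s t : ℝ)
    (hs : 0 ≤ s) (ht : 0 ≤ t) :
    ‖T s x - T t x‖ ≤ M * ‖T |s - t| x - x‖ := by
  obtain ⟨h0, hadd, hc⟩ := hT
  have key : ∀ a b : ℝ, 0 ≤ a → a ≤ b → ‖T b x - T a x‖ ≤ M * ‖T (b - a) x - x‖ := by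
    intro a b ha hab
    have h1 : T b x - T a x = T a (T (b - a) x - x) := by
      have h2 := hadd a (b - a) ha (by linarith)
      rw [add_sub_cancel] at h2
      rw [map_sub, h2]
      rfl
    rw [h1]
    exact (T a).le_of_opNorm_le (hM a ha) _
  rcases le_total t s with h | h
  · rw [abs_of_nonneg (by linarith)]
    exact key t s ht h
  · rw [abs_of_nonpos (by linarith), norm_sub_rev, neg_sub]
    exact key s t hs h

theorem sdb_linear
    {X : Type*} [NormedAddCommGroup X] [NormedSpace ℂ X]
    (T : ℝ → X →L[ℂ] X) (M : ℝ)
    (hT : IsC0Semigroup T) (hM : ∀ t, 0 ≤ t → ‖T t‖ ≤ M) (x y : X)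
    (hy : InGenDomain T x y) (u : ℝ) (hu : 0 < u) :
    ‖T u x - x‖ ≤ M * ‖y‖ * u := by
  have hcont : ContinuousOn (fun t => T t x) (Set.Icc 0 u) := by
    intro t ht
    rw [ContinuousWithinAt, tendsto_iff_norm_sub_tendsto_zero]
    have h1 : Tendsto (fun s : ℝ => |s - t|) (𝓝[Set.Icc 0 u] t) (𝓝[≥] 0) := by
      apply tendsto_nhdsWithin_iff.2
      refine ⟨?_, Eventually.of_forall fun s => Set.mem_Ici.2 (abs_nonneg _)⟩
      have : Continuous (fun s : ℝ => |s - t|) := by fun_prop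
      have h := this.tendsto t
      simp only [sub_self, abs_zero] at h
      exact h.mono_left nhdsWithin_le_nhds
    have h2 := (tendsto_iff_norm_sub_tendsto_zero.1 ((hT.2.2 x).comp h1)).const_mul M
    rw [mul_zero] at h2
    refine squeeze_zero' (Eventually.of_forall fun s => norm_nonneg _) ?_ h2
    filter_upwards [self_mem_nhdsWithin] with s hs
    exact sdb_lip_aux T M hT hM x s t hs.1 ht.1
  have hder : ∀ t ∈ Set.Ico 0 u, HasDerivWithinAt (fun t => T t x) (T t y) (Set.Ici t) t := by
    intro t ht
    rw [hasDerivWithinAt_iff_tendsto_slope]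
    have hset : Set.Ici t \ {t} = Set.Ioi t := by
      ext z
      simp only [Set.mem_sdiff, Set.mem_Ici, Set.mem_singleton_iff, Set.mem_Ioi]
      exact ⟨fun h => lt_of_le_of_ne h.1 (Ne.symm h.2), fun h => ⟨h.le, h.ne'⟩⟩
    rw [hset]
    have h1 : Tendsto (fun s : ℝ => s - t) (𝓝[>] t) (𝓝[>] 0) := by
      apply tendsto_nhdsWithin_iff.2
      refine ⟨?_, ?_⟩
      · have : Continuous (fun s : ℝ => s - t) := by fun_prop
        have h := this.tendsto t
        simp only [sub_self] at h
        exact h.mono_left nhdsWithin_le_nhds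
      · filter_upwards [self_mem_nhdsWithin] with s hs
        exact Set.mem_Ioi.2 (sub_pos.2 (Set.mem_Ioi.1 hs))
    have h2 := ((T t).continuous.tendsto y).comp (Tendsto.comp hy h1)
    refine h2.congr' ?_
    filter_upwards [self_mem_nhdsWithin] with s hs
    have hs' : t < s := hs
    have h3 := hT.2.1 t (s - t) ht.1 (by linarith)
    rw [add_sub_cancel] at h3
    simp only [Function.comp, slope_def_module]
    rw [h3, (T t).map_smul_of_tower, map_sub]
    rfl
  have hb : ∀ t ∈ Set.Ico 0 u, ‖T t y‖ ≤ M * ‖y‖ := fun t ht =>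
    (T t).le_of_opNorm_le (hM t ht.1) _
  have := norm_image_sub_le_of_norm_deriv_right_le_segment hcont hder hb u ⟨hu.le, le_rfl⟩
  simpa [hT.1] using this

/-- Let `T` be a one-parameter `C₀`-semigroup with generator `A` and
`‖T(t)‖ ≤ M` (`M ≥ 1`). Then for every `x ∈ D(A)` with `‖x‖ = 1` (with `A x = y`) and
every `u > 0`, `‖(T(u) - I)x‖ ≤ K_M·(1 - e^{-‖Ax‖u})`,
where `K_M = (M+1)/(1 - e^{-(M+1)/M})`. -/
theorem semigroup_difference_bound
    {X : Type*} [NormedAddCommGroup X] [NormedSpace ℂ X] [CompleteSpace X]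
    (T : ℝ → X →L[ℂ] X) (M : ℝ) (hM1 : 1 ≤ M)
    (hT : IsC0Semigroup T) (hM : ∀ t, 0 ≤ t → ‖T t‖ ≤ M)
    (x : X) (hx : ‖x‖ = 1) (y : X) (hy : InGenDomain T x y)
    (u : ℝ) (hu : 0 < u) :
    ‖T u x - x‖ ≤ KM M * (1 - Real.exp (-(‖y‖ * u))) := by
  have hlin := sdb_linear T M hT hM x y hy u hu
  have hbd : ‖T u x - x‖ ≤ M + 1 := by
    have h1 := (T u).le_of_opNorm_le (hM u hu.le) x
    have h2 := norm_sub_le (T u x) x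
    rw [hx] at h1 h2
    linarith
  have hM0 : 0 < M := by linarith
  unfold KM
  rw [neg_div]
  obtain ⟨c, hc⟩ : ∃ c, c = (M + 1) / M := ⟨_, rfl⟩
  obtain ⟨s, hs⟩ : ∃ s, s = ‖y‖ * u := ⟨_, rfl⟩
  rw [← hc, ← hs]
  rw [mul_assoc, ← hs] at hlin
  have hs0 : 0 ≤ s := by rw [hs]; positivity
  have hc0 : 0 < c := by rw [hc]; positivity
  have hcM : M * c = M + 1 := by rw [hc]; field_simp
  have hE : 0 < 1 - Real.exp (-c) := by
    have : Real.exp (-c) < 1 := Real.exp_lt_one_iff.2 (by linarith)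
    linarith
  rw [div_mul_eq_mul_div, le_div_iff₀ hE]
  rcases le_total c s with h | h
  · have : Real.exp (-s) ≤ Real.exp (-c) := Real.exp_le_exp.2 (by linarith)
    exact mul_le_mul hbd (by linarith) hE.le (by linarith)
  · have hconv := convexOn_exp.2 (Set.mem_univ (0:ℝ)) (Set.mem_univ (-c))
      (show 0 ≤ 1 - s / c by rw [sub_nonneg, div_le_one hc0]; exact h)
      (show 0 ≤ s / c by positivity) (by ring)
    have e1 : (1 - s / c) • (0:ℝ) + (s / c) • (-c) = -s := by
      simp only [smul_eq_mul]; field_simp; ring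
    rw [e1] at hconv
    simp only [smul_eq_mul, Real.exp_zero, mul_one] at hconv
    have h5 : s / c * (1 - Real.exp (-c)) ≤ 1 - Real.exp (-s) := by linarith
    calc ‖T u x - x‖ * (1 - Real.exp (-c)) ≤ (M * s) * (1 - Real.exp (-c)) := by gcongr
      _ = (M + 1) * (s / c * (1 - Real.exp (-c))) := by rw [← hcM]; field_simp
      _ ≤ _ := by gcongr
end

section
/- Let T₁,…,Tₙ be pairwise commuting C₀-semigroups on a complex Banach space X with ‖Tⱼ(t)‖ ≤ Mⱼ, and let T(u) = T₁(u₁)⋯Tₙ(uₙ) for u ∈ ℝ₊ⁿ. Then for all u ∈ ℝ₊ⁿ, ‖I − T(u)‖ ≤ Σⱼ₌₁ⁿ Cⱼ·‖I − Tⱼ(uⱼ)‖, where C₁ = 1 and Cⱼ = M₁⋯M_{j−1} for j > 1. In particular, if ‖Tⱼ(t)‖ ≤ M for all j, then for every x ∈ D(A) with ‖x‖ = 1, ‖(T(u) − I)x‖ ≤ n·K_M·M^{n−1}·(1 − e^{−(Σⱼ‖Aⱼx‖uⱼ)/n}), where K_M = (M+1)/(1 − e^{−(M+1)/M}). -/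
open MeasureTheory Filter Topology

theorem aux_prod {X : Type*} [NormedAddCommGroup X] [NormedSpace ℂ X] (x : X) :
    ∀ {n : ℕ} (a : Fin n → X →L[ℂ] X) (M : Fin n → ℝ), (∀ j, ‖a j‖ ≤ M j) →
      ‖(List.ofFn a).prod x - x‖ ≤ ∑ j, (∏ k ∈ Finset.Iio j, M k) * ‖a j x - x‖ := by
  intro n
  induction n with
  | zero => intro a M _; simp
  | succ n ih =>
    intro a M h
    have h1 := ih (fun j => a j.succ) (fun j => M j.succ) (fun j => h _)
    have h0 : 0 ≤ M 0 := (norm_nonneg _).trans (h 0)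
    have hp : ∀ j : Fin n, ∏ k ∈ Finset.Iio j.succ, M k =
        M 0 * ∏ k ∈ Finset.Iio j, M k.succ := by
      intro j
      have e1 : Finset.Iio j.succ = Finset.univ.filter (· < j.succ) := by ext; simp
      have e2 : Finset.Iio j = Finset.univ.filter (· < j) := by ext; simp
      rw [e1, e2, Finset.prod_filter, Finset.prod_filter, Fin.prod_univ_succ]
      simp
    rw [List.ofFn_succ, List.prod_cons, Fin.sum_univ_succ]
    have e : (a 0 * (List.ofFn fun i : Fin n => a i.succ).prod) x - x =
        (a 0 x - x) + a 0 ((List.ofFn fun i : Fin n => a i.succ).prod x - x) := by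
      rw [mul_apply_eq_comp, map_sub]; abel
    rw [e]
    refine (norm_add_le _ _).trans (add_le_add ?_ ?_)
    · have : Finset.Iio (0 : Fin (n+1)) = ∅ := by ext; simp
      rw [this]; simp
    · refine ((a 0).le_opNorm _).trans ?_
      refine (mul_le_mul (h 0) h1 (norm_nonneg _) h0).trans ?_
      rw [Finset.mul_sum]
      refine le_of_eq (Finset.sum_congr rfl fun j _ => ?_)
      rw [hp]; ring

theorem aux_step {X : Type*} [NormedAddCommGroup X] [NormedSpace ℂ X]
    (T : ℝ → X →L[ℂ] X) (hT : IsC0Semigroup T) (M : ℝ) (hM : ∀ t, 0 ≤ t → ‖T t‖ ≤ M)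
    (x : X) (h : ℝ) (hh : 0 ≤ h) (m : ℕ) :
    ‖T (m * h) x - x‖ ≤ m * (M * ‖T h x - x‖) := by
  induction m with
  | zero => simp [hT.1]
  | succ m ih =>
    have hmh : 0 ≤ (m : ℝ) * h := by positivity
    have e : T ((m + 1 : ℕ) * h) x - x = (T (m * h) x - x) + T (m * h) (T h x - x) := by
      have : ((m + 1 : ℕ) : ℝ) * h = m * h + h := by push_cast; ring
      rw [this, hT.2.1 _ _ hmh hh, map_sub, ContinuousLinearMap.comp_apply]; abel
    rw [e]
    have h2 : ‖T (m * h) (T h x - x)‖ ≤ M * ‖T h x - x‖ :=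
      ((T (m * h)).le_opNorm _).trans (mul_le_mul_of_nonneg_right (hM _ hmh) (norm_nonneg _))
    have h3 := norm_add_le (T (m * h) x - x) (T (m * h) (T h x - x))
    push_cast
    linarith

theorem aux_gen {X : Type*} [NormedAddCommGroup X] [NormedSpace ℂ X]
    (T : ℝ → X →L[ℂ] X) (hT : IsC0Semigroup T) (M : ℝ) (hM : ∀ t, 0 ≤ t → ‖T t‖ ≤ M)
    (x y : X) (hxy : InGenDomain T x y) (t : ℝ) (ht : 0 ≤ t) :
    ‖T t x - x‖ ≤ M * (‖y‖ * t) := by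
  rcases ht.eq_or_lt with rfl | ht
  · simp [hT.1]
  have hlim : Tendsto (fun m : ℕ => t / ((m : ℝ) + 1)) atTop (𝓝[>] (0 : ℝ)) := by
    refine tendsto_nhdsWithin_iff.2 ⟨?_, Eventually.of_forall fun m => ?_⟩
    · have := (tendsto_one_div_add_atTop_nhds_zero_nat (𝕜 := ℝ)).const_mul t
      simpa [div_eq_mul_inv] using this
    · simp only [Set.mem_Ioi]; positivity
  have h1 := ((hxy.comp hlim).norm.mul_const t).const_mul M
  refine ge_of_tendsto h1 (Eventually.of_forall fun m => ?_)
  have hm : (0 : ℝ) < (m : ℝ) + 1 := by positivity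
  have h2 := aux_step T hT M hM x (t / ((m : ℝ) + 1)) (by positivity) (m + 1)
  have e : ((m + 1 : ℕ) : ℝ) * (t / ((m : ℝ) + 1)) = t := by push_cast; field_simp
  rw [e] at h2
  refine h2.trans (le_of_eq ?_)
  simp only [Function.comp]
  rw [norm_smul, Real.norm_of_nonneg (by positivity)]
  push_cast
  field_simp

theorem aux_KM (M s r : ℝ) (hM : 1 ≤ M) (hs : 0 ≤ s) (h1 : r ≤ M + 1) (h2 : r ≤ M * s) :
    r ≤ KM M * (1 - Real.exp (-s)) := by
  have hM0 : 0 < M := by linarith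
  have ha : 0 < (M + 1) / M := by positivity
  have hea : Real.exp (-(M + 1) / M) < 1 := by
    rw [Real.exp_lt_one_iff, neg_div]; linarith
  have hd : 0 < 1 - Real.exp (-(M + 1) / M) := by linarith
  unfold KM
  rw [div_mul_eq_mul_div, le_div_iff₀ hd]
  rcases le_total ((M + 1) / M) s with h | h
  · have : Real.exp (-s) ≤ Real.exp (-(M + 1) / M) := by
      apply Real.exp_le_exp.2; rw [neg_div]; linarith
    nlinarith
  · set l := s * M / (M + 1) with hl
    have hl0 : 0 ≤ l := by positivity
    have hl1 : l ≤ 1 := by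
      rw [hl, div_le_one (by positivity)]
      rwa [le_div_iff₀ hM0] at h
    have hc := convexOn_exp.2 (Set.mem_univ (-(M + 1) / M)) (Set.mem_univ 0) hl0
      (sub_nonneg.2 hl1) (by ring)
    simp only [smul_eq_mul, mul_zero, add_zero, Real.exp_zero, mul_one] at hc
    have e : l * (-(M + 1) / M) = -s := by rw [hl]; field_simp
    rw [e] at hc
    have e2 : M * s = l * (M + 1) := by rw [hl]; field_simp
    rw [e2] at h2
    nlinarith

/-- For pairwise commuting `C₀`-semigroups `T₁,…,Tₙ` with
`‖Tⱼ(t)‖ ≤ Mⱼ` and `T(u) = T₁(u₁)⋯Tₙ(uₙ)`: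
(i) `‖I - T(u)‖ ≤ Σⱼ Cⱼ ‖I - Tⱼ(uⱼ)‖` with `C₁ = 1`, `Cⱼ = M₁⋯M_{j-1}`;
(ii) if moreover `‖Tⱼ(t)‖ ≤ M` (`M ≥ 1`) for all `j`, then for `x ∈ D(A)`, `‖x‖ = 1`
(with `Aⱼ x = yⱼ`) and `u ∈ ℝ₊ⁿ`,
`‖(T(u) - I)x‖ ≤ n·K_M·M^{n-1}·(1 - e^{-(Σⱼ ‖Aⱼx‖ uⱼ)/n})`. -/
theorem product_semigroup_difference_bounds
    {X : Type*} [NormedAddCommGroup X] [NormedSpace ℂ X] [CompleteSpace X]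
    {n : ℕ} (hn : 0 < n) (T : Fin n → ℝ → X →L[ℂ] X) (M : Fin n → ℝ)
    (hT : ∀ j, IsC0Semigroup (T j)) (hM : ∀ j t, 0 ≤ t → ‖T j t‖ ≤ M j)
    (hcomm : ∀ i j s t, 0 ≤ s → 0 ≤ t → T i s ∘L T j t = T j t ∘L T i s) :
    (∀ u : Fin n → ℝ, (∀ j, 0 ≤ u j) →
      ‖(1 : X →L[ℂ] X) - Tprod T u‖ ≤
        ∑ j, (∏ k ∈ Finset.Iio j, M k) * ‖(1 : X →L[ℂ] X) - T j (u j)‖) ∧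
    ∀ M' : ℝ, 1 ≤ M' → (∀ j t, 0 ≤ t → ‖T j t‖ ≤ M') →
      ∀ (x : X), ‖x‖ = 1 → ∀ y : Fin n → X, (∀ j, InGenDomain (T j) x (y j)) →
      ∀ u : Fin n → ℝ, (∀ j, 0 ≤ u j) →
        ‖Tprod T u x - x‖ ≤
          (n : ℝ) * KM M' * M' ^ (n - 1) *
            (1 - Real.exp (-(∑ j, ‖y j‖ * u j) / n)) := by
  refine ⟨fun u hu => ?_, fun M' hM' hMM x hx y hy u hu => ?_⟩
  · rw [norm_sub_rev]
    have hC : ∀ j : Fin n, 0 ≤ ∏ k ∈ Finset.Iio j, M k := fun j =>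
      Finset.prod_nonneg fun k _ => (norm_nonneg _).trans (hM k 0 le_rfl)
    refine ContinuousLinearMap.opNorm_le_bound _
      (Finset.sum_nonneg fun j _ => mul_nonneg (hC j) (norm_nonneg _)) fun x => ?_
    have := aux_prod x (fun j => T j (u j)) M (fun j => hM j _ (hu j))
    refine this.trans ?_
    rw [Finset.sum_mul]
    refine Finset.sum_le_sum fun j _ => ?_
    rw [mul_assoc]
    refine mul_le_mul_of_nonneg_left ?_ (hC j)
    rw [norm_sub_rev (1 : X →L[ℂ] X)]
    exact (T j (u j) - 1).le_opNorm x
  · have hM0 : 0 < M' := by linarith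
    have hn' : (0 : ℝ) < n := by exact_mod_cast hn
    have hK : 0 ≤ KM M' := by
      unfold KM
      refine div_nonneg (by linarith) (sub_nonneg.2 (Real.exp_le_one_iff.2 ?_))
      rw [neg_div]; have : 0 < (M' + 1) / M' := by positivity
      linarith
    have h1 := aux_prod x (fun j => T j (u j)) (fun _ => M') (fun j => hMM j _ (hu j))
    have h2 : ∀ j, ‖T j (u j) x - x‖ ≤ KM M' * (1 - Real.exp (-(‖y j‖ * u j))) := by
      intro j
      refine aux_KM _ _ _ hM' (mul_nonneg (norm_nonneg _) (hu j)) ?_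
        (aux_gen (T j) (hT j) M' (hMM j) x (y j) (hy j) _ (hu j))
      have h3 := (T j (u j)).le_opNorm x
      have h4 := hMM j _ (hu j)
      have h5 := norm_sub_le (T j (u j) x) x
      rw [hx] at h3 h5
      linarith
    have hJ : ∑ j, (1 - Real.exp (-(‖y j‖ * u j))) ≤
        n * (1 - Real.exp (-(∑ j, ‖y j‖ * u j) / n)) := by
      have hc := convexOn_exp.map_sum_le (t := (Finset.univ : Finset (Fin n)))
        (w := fun _ => (n : ℝ)⁻¹) (p := fun j => -(‖y j‖ * u j)) (fun _ _ => by positivity)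
        (by simp [hn'.ne']) (fun _ _ => Set.mem_univ _)
      simp only [smul_eq_mul] at hc
      rw [← Finset.mul_sum, ← Finset.mul_sum, Finset.sum_neg_distrib, mul_comm, ← div_eq_mul_inv,
        inv_mul_eq_div, le_div_iff₀ hn'] at hc
      rw [Finset.sum_sub_distrib]
      simp only [Finset.sum_const, Finset.card_univ, Fintype.card_fin, nsmul_eq_mul]
      linarith
    have hM1 : 0 ≤ M' ^ (n - 1) := by positivity
    calc ‖Tprod T u x - x‖ ≤ _ := h1
      _ ≤ ∑ j, M' ^ (n - 1) * (KM M' * (1 - Real.exp (-(‖y j‖ * u j)))) := by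
        refine Finset.sum_le_sum fun j _ => mul_le_mul ?_ (h2 j) (norm_nonneg _) hM1
        rw [Finset.prod_const, Fin.card_Iio]
        exact pow_le_pow_right₀ hM' (by omega)
      _ = M' ^ (n - 1) * KM M' * ∑ j, (1 - Real.exp (-(‖y j‖ * u j))) := by
        rw [Finset.mul_sum]; exact Finset.sum_congr rfl fun _ _ => by ring
      _ ≤ M' ^ (n - 1) * KM M' * (n * (1 - Real.exp (-(∑ j, ‖y j‖ * u j) / n))) :=
        mul_le_mul_of_nonneg_left hJ (mul_nonneg hM1 hK)
      _ = _ := by ring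
end

section
/- Let ψ ∈ T_n, and for t ≥ 0 let ν_t be the unique bounded positive measure on ℝ₊ⁿ whose n-dimensional Laplace transform is e^{tψ}. Then the family (ν_t) converges narrowly (weakly against bounded continuous functions) to the Dirac measure ε₀ at the origin as t → +0. -/
open MeasureTheory Filter Topology

/-- Let `ψ ∈ 𝒯ₙ` and for `t ≥ 0` let `ν_t` be the unique bounded
positive measure on `ℝ₊ⁿ` whose Laplace transform is `e^{tψ}`. Then `ν_t` converges
narrowly (i.e. tested against every bounded continuous function) to the Dirac measure
`ε₀` at the origin as `t → +0`. -/
theorem subordinator_tendsto_dirac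
    {n : ℕ} (ψ : (Fin n → ℝ) → ℝ) (hψ : MemTn n ψ)
    (ν : ℝ → MeasureTheory.Measure (Fin n → ℝ)) (hν : IsSubordinator n ψ ν) :
    ∀ f : BoundedContinuousFunction (Fin n → ℝ) ℝ,
      Tendsto (fun t => ∫ u, f u ∂(ν t)) (𝓝[>] (0 : ℝ)) (𝓝 (f 0)) := by
  intro f
  have hmem : ∀ c : ℝ, 0 < c → (fun _ : Fin n => -c) ∈ negOrthant n := by
    intro c hc j
    simpa using hc
  have hsum : ∀ (c : ℝ) (u : Fin n → ℝ), ∑ j, (-c) * u j = -(c * ∑ j, u j) := by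
    intro c u
    rw [← Finset.mul_sum]; ring
  have hnn : ∀ t : ℝ, 0 ≤ t → ∀ᵐ u ∂(ν t), ∀ j, 0 ≤ u j := by
    intro t ht
    exact (hν t ht).2.1
  have hint : ∀ t : ℝ, 0 ≤ t → ∀ c : ℝ, 0 < c →
      Integrable (fun u : Fin n → ℝ => Real.exp (-(c * ∑ j, u j))) (ν t) := by
    intro t ht c hc
    have := (hν t ht).1
    refine Integrable.of_bound (C := 1) ?_ ?_
    · exact Continuous.aestronglyMeasurable (by fun_prop)
    · filter_upwards [hnn t ht] with u hu
      rw [Real.norm_eq_abs, Real.abs_exp, Real.exp_le_one_iff]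
      have := Finset.sum_nonneg (fun j (_ : j ∈ Finset.univ) => hu j)
      nlinarith [mul_nonneg hc.le this]
  have hlap : ∀ t : ℝ, 0 ≤ t → ∀ c : ℝ, 0 < c →
      ∫ u, Real.exp (-(c * ∑ j, u j)) ∂(ν t) = Real.exp (t * ψ (fun _ => -c)) := by
    intro t ht c hc
    rw [← (hν t ht).2.2 _ (hmem c hc)]
    simp only [hsum]
  have hmass : ∀ t : ℝ, 0 ≤ t → (ν t).real Set.univ ≤ 1 := by
    intro t ht
    have := (hν t ht).1
    have hl : Tendsto (fun k : ℕ => ∫ u, Real.exp (-((1 / ((k : ℝ) + 1)) * ∑ j, u j)) ∂(ν t))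
        atTop (𝓝 (∫ u, (1 : ℝ) ∂(ν t))) := by
      refine tendsto_integral_of_dominated_convergence (fun _ => (1 : ℝ)) ?_ (by fun_prop) ?_ ?_
      · intro k
        exact Continuous.aestronglyMeasurable (by fun_prop)
      · intro k
        filter_upwards [hnn t ht] with u hu
        rw [Real.norm_eq_abs, Real.abs_exp, Real.exp_le_one_iff]
        have := Finset.sum_nonneg (fun j (_ : j ∈ Finset.univ) => hu j)
        have : 0 ≤ (1 / ((k : ℝ) + 1)) * ∑ j, u j := by positivity
        linarith
      · refine Eventually.of_forall fun u => ?_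
        have h1 : Tendsto (fun k : ℕ => Real.exp (-((1 / ((k : ℝ) + 1)) * ∑ j, u j)))
            atTop (𝓝 (Real.exp (-(0 * ∑ j, u j)))) :=
          (Real.continuous_exp.tendsto _).comp
            ((tendsto_one_div_add_atTop_nhds_zero_nat.mul_const _).neg)
        simpa using h1
    have h2 := le_of_tendsto hl (b := 1) (Eventually.of_forall fun k => by
      have hk : (0 : ℝ) < 1 / ((k : ℝ) + 1) := by positivity
      rw [hlap t ht _ hk, Real.exp_le_one_iff]
      exact mul_nonpos_of_nonneg_of_nonpos ht (hψ.2.1 _ (hmem _ hk)))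
    simpa using h2
  have hE : Tendsto (fun t : ℝ => Real.exp (t * ψ (fun _ => -1))) (𝓝[>] (0 : ℝ)) (𝓝 1) := by
    have : Continuous (fun t : ℝ => Real.exp (t * ψ (fun _ => -1))) := by fun_prop
    have h := (this.tendsto 0).mono_left (nhdsWithin_le_nhds (s := Set.Ioi 0))
    simpa using h
  have hle : ∀ t : ℝ, 0 ≤ t → Real.exp (t * ψ (fun _ => -1)) ≤ (ν t).real Set.univ := by
    intro t ht
    have := (hν t ht).1
    rw [← hlap t ht 1 one_pos]
    calc _ ≤ ∫ u, (1 : ℝ) ∂(ν t) := by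
          refine integral_mono_ae (hint t ht 1 one_pos) (integrable_const _) ?_
          filter_upwards [hnn t ht] with u hu
          have := Finset.sum_nonneg (fun j (_ : j ∈ Finset.univ) => hu j)
          show Real.exp _ ≤ 1
          rw [Real.exp_le_one_iff]
          linarith
      _ = _ := by simp
  -- the key estimate
  rw [Metric.tendsto_nhds]
  intro ε hε
  obtain ⟨δ, hδ, hfδ⟩ := Metric.continuous_iff.1 f.continuous 0 (ε / 2) (half_pos hε)
  have hq : 0 < 1 - Real.exp (-δ) := by
    have : Real.exp (-δ) < 1 := by rw [Real.exp_lt_one_iff]; linarith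
    linarith
  set C : ℝ := 2 * ‖f‖ / (1 - Real.exp (-δ)) with hC
  have hC0 : 0 ≤ C := by positivity
  have hpt : ∀ t : ℝ, 0 ≤ t → ∀ᵐ u ∂(ν t),
      ‖f u - f 0‖ ≤ ε / 2 + C * (1 - Real.exp (-(1 * ∑ j, u j))) := by
    intro t ht
    filter_upwards [hnn t ht] with u hu
    have hs := Finset.sum_nonneg (fun j (_ : j ∈ Finset.univ) => hu j)
    have he : Real.exp (-(1 * ∑ j, u j)) ≤ 1 := by
      rw [Real.exp_le_one_iff]; linarith
    by_cases hud : dist u 0 < δ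
    · have := hfδ u hud
      rw [dist_eq_norm] at this
      have := mul_nonneg hC0 (sub_nonneg.2 he)
      linarith
    · have hle : δ ≤ ∑ j, u j := by
        refine (not_lt.1 hud).trans ?_
        rw [dist_zero_right, pi_norm_le_iff_of_nonneg hs]
        intro j
        rw [Real.norm_eq_abs, abs_of_nonneg (hu j)]
        exact Finset.single_le_sum (fun j _ => hu j) (Finset.mem_univ j)
      have h1 : Real.exp (-(1 * ∑ j, u j)) ≤ Real.exp (-δ) := by
        apply Real.exp_le_exp.2; linarith
      have h2 : ‖f u - f 0‖ ≤ 2 * ‖f‖ := by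
        rw [← dist_eq_norm]; exact f.dist_le_two_norm u 0
      have h3 : 2 * ‖f‖ = C * (1 - Real.exp (-δ)) := by
        rw [hC]; field_simp
      have h4 := mul_le_mul_of_nonneg_left (sub_le_sub_left h1 1) hC0
      linarith
  have hlim : Tendsto (fun t : ℝ => ε / 2 + (C + |f 0|) * (1 - Real.exp (t * ψ (fun _ => -1))))
      (𝓝[>] (0 : ℝ)) (𝓝 (ε / 2 + (C + |f 0|) * (1 - 1))) :=
    ((hE.const_sub 1).const_mul _).const_add _
  have hev := hlim.eventually_lt_const (u := ε) (by simp; linarith)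
  filter_upwards [hev, self_mem_nhdsWithin] with t ht1 ht0
  have ht : 0 ≤ t := le_of_lt ht0
  have := (hν t ht).1
  refine lt_of_le_of_lt ?_ ht1
  set m := (ν t).real Set.univ with hm
  have hm1 : m ≤ 1 := hmass t ht
  have hm2 := hle t ht
  have hfi : Integrable f (ν t) := f.integrable _
  have e1 : ∫ u, (f u - f 0) ∂(ν t) = ∫ u, f u ∂(ν t) - m * f 0 := by
    rw [integral_sub hfi (integrable_const _)]; simp [hm]
  have hI : Integrable (fun u : Fin n → ℝ => C * (1 - Real.exp (-(1 * ∑ j, u j)))) (ν t) :=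
    ((integrable_const _).sub (hint t ht 1 one_pos)).const_mul C
  have e2 : ∫ u, (ε / 2 + C * (1 - Real.exp (-(1 * ∑ j, u j)))) ∂(ν t)
      = m * (ε / 2) + C * (m - Real.exp (t * ψ (fun _ => -1))) := by
    rw [integral_add (integrable_const _) hI, integral_const_mul,
      integral_sub (integrable_const _) (hint t ht 1 one_pos), hlap t ht 1 one_pos]
    simp [hm]
  have e3 : ‖∫ u, (f u - f 0) ∂(ν t)‖ ≤
      m * (ε / 2) + C * (m - Real.exp (t * ψ (fun _ => -1))) := by
    rw [← e2]
    exact norm_integral_le_of_norm_le ((integrable_const _).add hI) (hpt t ht)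
  rw [e1, Real.norm_eq_abs] at e3
  rw [Real.dist_eq]
  have e4 : ∫ u, f u ∂(ν t) - f 0 = (∫ u, f u ∂(ν t) - m * f 0) + (m - 1) * f 0 := by ring
  rw [e4]
  refine (abs_add_le _ _).trans ?_
  have e5 : |(m - 1) * f 0| = (1 - m) * |f 0| := by
    rw [abs_mul, abs_of_nonpos (by linarith)]; ring
  rw [e5]
  have e6 : (1 - m) * |f 0| ≤ (1 - Real.exp (t * ψ (fun _ => -1))) * |f 0| :=
    mul_le_mul_of_nonneg_right (by linarith) (abs_nonneg _)
  have e7 : C * (m - Real.exp (t * ψ (fun _ => -1))) ≤ C * (1 - Real.exp (t * ψ (fun _ => -1))) :=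
    mul_le_mul_of_nonneg_left (by linarith) hC0
  have e8 : m * (ε / 2) ≤ ε / 2 := by nlinarith
  linarith
end

section
/- Let ψ ∈ T_n with representation ψ(s) = c₀ + c₁·s + ∫_{ℝ₊ⁿ\{0}}(e^{s·u} − 1)dμ(u), and let A = (A₁,…,Aₙ) be pairwise commuting generators of uniformly bounded C₀-semigroups T₁,…,Tₙ on a complex Banach space X with ‖Tⱼ(t)‖ ≤ M. For ε > 0 let A − ε̄I = (A₁ − εI, …, Aₙ − εI) (the generators of the semigroups e^{−εuⱼ}Tⱼ(uⱼ)). Then for every x ∈ D(A), ψ(A − ε̄I)x → ψ(A)x in X as ε ↓ 0; indeed ‖ψ(A)x − ψ(A − ε̄I)x‖ ≤ (|ψ(−0) − ψ(−ε̄)| + (Mⁿ + 1)∫_{ℝ₊ⁿ}(1 − e^{−ε(u₁+⋯+uₙ)})dμ(u))·‖x‖. -/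
open MeasureTheory Filter Topology

lemma orbit_cont {X : Type*} [NormedAddCommGroup X] [NormedSpace ℂ X]
    (T : ℝ → X →L[ℂ] X) (M : ℝ) (hT : IsC0Semigroup T) (hM : ∀ t, 0 ≤ t → ‖T t‖ ≤ M)
    (x : X) : ContinuousOn (fun t => T t x) (Set.Ici 0) := by
  obtain ⟨h0, hadd, hlim⟩ := hT
  have key : ∀ s t : ℝ, 0 ≤ s → 0 ≤ t → ‖T t x - T s x‖ ≤ M * ‖T |t - s| x - x‖ := by
    have aux : ∀ s t : ℝ, 0 ≤ s → s ≤ t → ‖T t x - T s x‖ ≤ M * ‖T |t - s| x - x‖ := by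
      intro s t hs hst
      rw [abs_of_nonneg (by linarith)]
      have : T t x - T s x = T s (T (t - s) x - x) := by
        have h := hadd s (t - s) hs (by linarith)
        rw [show s + (t - s) = t by ring] at h
        rw [h, map_sub]; rfl
      rw [this]
      exact (T s).le_of_opNorm_le (hM s hs) _
    intro s t hs ht
    rcases le_total s t with h | h
    · exact aux s t hs h
    · rw [norm_sub_rev, abs_sub_comm]; exact aux t s ht h
  intro s hs
  have hs' : (0 : ℝ) ≤ s := hs
  have h1 : Tendsto (fun t : ℝ => |t - s|) (𝓝[Set.Ici 0] s) (𝓝[≥] (0 : ℝ)) := by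
    rw [tendsto_nhdsWithin_iff]
    refine ⟨?_, Eventually.of_forall fun t => Set.mem_Ici.2 (abs_nonneg _)⟩
    have : Continuous (fun t : ℝ => |t - s|) := by fun_prop
    have h := this.tendsto s
    simp only [sub_self, abs_zero] at h
    exact h.mono_left nhdsWithin_le_nhds
  have h2 := ((hlim x).comp h1).sub_const x
  have h3 := (h2.norm).const_mul M
  simp only [sub_self, norm_zero, mul_zero] at h3
  change Tendsto _ _ _
  rw [tendsto_iff_norm_sub_tendsto_zero]
  refine squeeze_zero' (Eventually.of_forall fun t => norm_nonneg _) ?_ h3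
  filter_upwards [self_mem_nhdsWithin] with t ht
  exact key s t hs' ht

lemma orbit_lip {X : Type*} [NormedAddCommGroup X] [NormedSpace ℂ X]
    (T : ℝ → X →L[ℂ] X) (M : ℝ) (hT : IsC0Semigroup T) (hM : ∀ t, 0 ≤ t → ‖T t‖ ≤ M)
    (x y : X) (hy : InGenDomain T x y) (t : ℝ) (ht : 0 ≤ t) :
    ‖T t x - x‖ ≤ M * ‖y‖ * t := by
  have hc := (orbit_cont T M hT hM x).mono (Set.Icc_subset_Ici_self : Set.Icc 0 t ⊆ _)
  have hd : ∀ s ∈ Set.Ico 0 t, HasDerivWithinAt (fun t => T t x) (T s y) (Set.Ici s) s := by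
    intro s hs
    rw [← hasDerivWithinAt_Ioi_iff_Ici, hasDerivWithinAt_iff_tendsto_slope' (by simp)]
    have h1 : Tendsto (fun r : ℝ => r - s) (𝓝[>] s) (𝓝[>] (0 : ℝ)) := by
      rw [tendsto_nhdsWithin_iff]
      constructor
      · have : Continuous (fun r : ℝ => r - s) := by fun_prop
        have h := this.tendsto s
        simp only [sub_self] at h
        exact h.mono_left nhdsWithin_le_nhds
      · filter_upwards [self_mem_nhdsWithin] with r hr
        simpa using hr
    have h2 := ((T s).continuous.tendsto y).comp (hy.comp h1)
    refine h2.congr' ?_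
    filter_upwards [self_mem_nhdsWithin] with r hr
    have hr' : s < r := hr
    have h := hT.2.1 s (r - s) hs.1 (by linarith)
    rw [show s + (r - s) = r by ring] at h
    simp only [Function.comp, slope, vsub_eq_sub]
    rw [h, ContinuousLinearMap.map_smul_of_tower, map_sub]; rfl
  have := norm_image_sub_le_of_norm_deriv_right_le_segment hc hd
    (C := M * ‖y‖) (fun s hs => (T s).le_of_opNorm_le (hM s hs.1) _) t ⟨ht, le_rfl⟩
  simpa [hT.1] using this

lemma orbit_bd {X : Type*} [NormedAddCommGroup X] [NormedSpace ℂ X]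
    (T : ℝ → X →L[ℂ] X) (M : ℝ) (hT : IsC0Semigroup T) (hM : ∀ t, 0 ≤ t → ‖T t‖ ≤ M)
    (x y : X) (hy : InGenDomain T x y) (t : ℝ) (ht : 0 ≤ t) :
    ‖T t x - x‖ ≤ (M * ‖y‖ + (M + 1) * ‖x‖) * (1 - Real.exp (-t)) := by
  have h1 := orbit_lip T M hT hM x y hy t ht
  have h2 : ‖T t x - x‖ ≤ (M + 1) * ‖x‖ := by
    have := (T t).le_of_opNorm_le (hM t ht) x
    have := norm_sub_le (T t x) x
    linarith
  have hM0 : 0 ≤ M := (norm_nonneg _).trans (hM 0 le_rfl)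
  have h3 : t / (1 + t) ≤ 1 - Real.exp (-t) := by
    have h4 := Real.add_one_le_exp t
    have : Real.exp (-t) ≤ 1 / (1 + t) := by
      rw [Real.exp_neg, ← one_div]
      exact one_div_le_one_div_of_le (by linarith) (by linarith)
    have : t / (1 + t) = 1 - 1 / (1 + t) := by field_simp; ring
    linarith
  calc ‖T t x - x‖ ≤ (M * ‖y‖ + (M + 1) * ‖x‖) * (t / (1 + t)) := by
        rw [← mul_div_assoc, le_div_iff₀ (by linarith)]
        nlinarith
    _ ≤ _ := mul_le_mul_of_nonneg_left h3 (by positivity)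

lemma prod_norm {X : Type*} [NormedAddCommGroup X] [NormedSpace ℂ X] (M : ℝ) :
    ∀ {n : ℕ} (G : Fin n → X →L[ℂ] X) (_ : ∀ j, ‖G j‖ ≤ M) (x : X),
      ‖(List.ofFn G).prod x‖ ≤ M ^ n * ‖x‖ := by
  intro n
  induction n with
  | zero => intro G _ x; simp
  | succ n ih =>
    intro G hG x
    rw [List.ofFn_succ, List.prod_cons, mul_apply_eq_comp]
    have h := ih (fun j => G j.succ) (fun j => hG _) x
    have hM0 : 0 ≤ M := (norm_nonneg _).trans (hG 0)
    calc _ ≤ M * ‖(List.ofFn fun j => G j.succ).prod x‖ := (G 0).le_of_opNorm_le (hG 0) _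
      _ ≤ M * (M ^ n * ‖x‖) := by gcongr
      _ = _ := by ring

lemma prod_sub {X : Type*} [NormedAddCommGroup X] [NormedSpace ℂ X] (M : ℝ) (n : ℕ) :
    ∃ K : ℝ, ∀ (G : Fin n → X →L[ℂ] X) (_ : ∀ j, ‖G j‖ ≤ M) (x : X) (b : ℝ)
      (_ : ∀ j, ‖G j x - x‖ ≤ b), ‖(List.ofFn G).prod x - x‖ ≤ K * b := by
  induction n with
  | zero => exact ⟨0, fun G _ x b _ => by simp⟩
  | succ n ih =>
    obtain ⟨K, hK⟩ := ih
    refine ⟨M * K + 1, fun G hG x b hb => ?_⟩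
    rw [List.ofFn_succ, List.prod_cons, mul_apply_eq_comp]
    have h := hK (fun j => G j.succ) (fun j => hG _) x b (fun j => hb _)
    have hM0 : 0 ≤ M := (norm_nonneg _).trans (hG 0)
    set p := (List.ofFn fun j => G j.succ).prod x
    calc ‖G 0 p - x‖ = ‖G 0 (p - x) + (G 0 x - x)‖ := by rw [map_sub]; congr 1; abel
      _ ≤ ‖G 0 (p - x)‖ + ‖G 0 x - x‖ := norm_add_le _ _
      _ ≤ M * ‖p - x‖ + b := add_le_add ((G 0).le_of_opNorm_le (hG 0) _) (hb 0)
      _ ≤ M * (K * b) + b := by gcongr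
      _ = _ := by ring

lemma prod_cont {X : Type*} [NormedAddCommGroup X] [NormedSpace ℂ X] (M : ℝ) {Y : Type*}
    [TopologicalSpace Y] :
    ∀ {n : ℕ} (G : Fin n → Y → X →L[ℂ] X) (_ : ∀ j t, ‖G j t‖ ≤ M)
      (_ : ∀ j x, Continuous fun t => G j t x) (x : X),
      Continuous fun u : Y => (List.ofFn fun j => G j u).prod x := by
  intro n
  induction n with
  | zero => intro G _ _ x; simpa using continuous_const
  | succ n ih =>
    intro G hG hc x
    have h := ih (fun j => G j.succ) (fun j => hG _) (fun j => hc _) x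
    simp only [List.ofFn_succ, List.prod_cons, mul_apply_eq_comp]
    rw [continuous_iff_continuousAt] at h ⊢
    intro u
    have hu := h u
    set p : Y → X := fun u => (List.ofFn fun j : Fin n => G j.succ u).prod x
    change Tendsto (fun v => G 0 v (p v)) (𝓝 u) (𝓝 (G 0 u (p u)))
    have h1 : Tendsto (fun v => M * ‖p v - p u‖ + ‖G 0 v (p u) - G 0 u (p u)‖) (𝓝 u) (𝓝 0) := by
      have a := (tendsto_iff_norm_sub_tendsto_zero.1 hu).const_mul M
      have b := tendsto_iff_norm_sub_tendsto_zero.1 ((hc 0 (p u)).tendsto u)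
      simpa using a.add b
    rw [tendsto_iff_norm_sub_tendsto_zero]
    refine squeeze_zero (fun t => norm_nonneg _) (fun v => ?_) h1
    calc ‖G 0 v (p v) - G 0 u (p u)‖
        = ‖G 0 v (p v - p u) + (G 0 v (p u) - G 0 u (p u))‖ := by rw [map_sub]; congr 1; abel
      _ ≤ _ := (norm_add_le _ _).trans (by
        gcongr; exact (G 0 v).le_of_opNorm_le (hG 0 v) _)

/-- For `ψ ∈ 𝒯ₙ` with representation `(c₀, c₁, μ)` and pairwise
commuting generators `A` of `C₀`-semigroups with `‖Tⱼ(t)‖ ≤ M`, and for `ε > 0` let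
`A - ε̄I = (A₁ - εI, …, Aₙ - εI)` (generating the semigroups `e^{-ε uⱼ} Tⱼ(uⱼ)`). Then for
every `x ∈ D(A)` (with `Aⱼ x = yⱼ`):
`‖ψ(A)x - ψ(A - ε̄I)x‖ ≤ (|ψ(-0) - ψ(-ε̄)| + (Mⁿ + 1) ∫ (1 - e^{-ε(u₁+⋯+uₙ)}) dμ)·‖x‖`
(with `ψ(-0) = c₀`), and `ψ(A - ε̄I)x → ψ(A)x` as `ε ↓ 0`. -/
theorem approximation_by_shifted_generators
    {X : Type*} [NormedAddCommGroup X] [NormedSpace ℂ X] [CompleteSpace X]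
    {n : ℕ} (T : Fin n → ℝ → X →L[ℂ] X) (M : ℝ)
    (hT : ∀ j, IsC0Semigroup (T j)) (hM : ∀ j t, 0 ≤ t → ‖T j t‖ ≤ M)
    (hcomm : ∀ i j s t, 0 ≤ s → 0 ≤ t → T i s ∘L T j t = T j t ∘L T i s)
    (ψ : (Fin n → ℝ) → ℝ) (c₀ : ℝ) (c₁ : Fin n → ℝ)
    (μ : MeasureTheory.Measure (Fin n → ℝ))
    (hψ : MemTn n ψ) (hrep : HasLevyRep n ψ c₀ c₁ μ)
    (x : X) (y : Fin n → X) (hy : ∀ j, InGenDomain (T j) x (y j)) :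
    (∀ ε : ℝ, 0 < ε →
      ‖(c₀ • x + (∑ j, c₁ j • y j) + ∫ u, (Tprod T u x - x) ∂μ) -
          (c₀ • x + (∑ j, c₁ j • (y j - ε • x)) +
            ∫ u, (Real.exp (-(ε * ∑ j, u j)) • Tprod T u x - x) ∂μ)‖ ≤
        (|c₀ - ψ (fun _ => -ε)| +
            (M ^ n + 1) * ∫ u, (1 - Real.exp (-(ε * ∑ j, u j))) ∂μ) * ‖x‖) ∧
      Tendsto (fun ε : ℝ => c₀ • x + (∑ j, c₁ j • (y j - ε • x)) +
          ∫ u, (Real.exp (-(ε * ∑ j, u j)) • Tprod T u x - x) ∂μ)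
        (𝓝[>] (0 : ℝ))
        (𝓝 (c₀ • x + (∑ j, c₁ j • y j) + ∫ u, (Tprod T u x - x) ∂μ)) := by
  obtain ⟨hc0, hc1, hμ0, hint, hψeq⟩ := hrep
  have hae : ∀ᵐ u ∂μ, (∀ j, 0 ≤ u j) ∧ u ≠ 0 := hμ0
  have hsum : ∀ (ε : ℝ) (u : Fin n → ℝ), ∑ j, -ε * u j = -(ε * ∑ j, u j) := by
    intro ε u
    rw [← Finset.mul_sum]; ring
  have hwint : ∀ ε : ℝ, 0 < ε → Integrable (fun u : Fin n → ℝ => 1 - Real.exp (-(ε * ∑ j, u j))) μ := by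
    intro ε hε
    have h := (hint (fun _ => -ε) (fun j => by simpa using hε)).neg
    refine h.congr (Eventually.of_forall fun u => ?_)
    simp only [Pi.neg_apply, hsum]; ring
  have hψε : ∀ ε : ℝ, 0 < ε → c₀ - ψ (fun _ => -ε) =
      ε * ∑ j, c₁ j + ∫ u, (1 - Real.exp (-(ε * ∑ j, u j))) ∂μ := by
    intro ε hε
    rw [hψeq (fun _ => -ε) (fun j => by simpa using hε)]
    have : ∫ u : Fin n → ℝ, (Real.exp (∑ j, -ε * u j) - 1) ∂μ
        = - ∫ u, (1 - Real.exp (-(ε * ∑ j, u j))) ∂μ := by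
      rw [← integral_neg]
      congr 1; ext u; rw [hsum]; ring
    simp only [this, ← Finset.sum_mul]
    ring
  have hMn : 0 ≤ M ^ n := by
    rcases Nat.eq_zero_or_pos n with h | h
    · subst h; simp
    · have : 0 ≤ M := (norm_nonneg _).trans (hM ⟨0, h⟩ 0 le_rfl)
      positivity
  have hmeas : AEStronglyMeasurable (fun u => Tprod T u x) μ := by
    have hcont := prod_cont M (fun (j : Fin n) (u : Fin n → ℝ) => T j (max (u j) 0))
      (fun j u => hM j _ (le_max_right _ _)) (fun j z =>
        (orbit_cont (T j) M (hT j) (hM j) z).comp_continuous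
          (f := fun u : Fin n → ℝ => max (u j) 0) (by fun_prop) (fun u => Set.mem_Ici.2 (le_max_right _ _))) x
    refine (hcont.aestronglyMeasurable (μ := μ)).congr ?_
    filter_upwards [hae] with u hu
    simp only [Tprod, max_eq_left (hu.1 _)]
  have hTb : ∀ᵐ u ∂μ, ‖Tprod T u x‖ ≤ M ^ n * ‖x‖ := by
    filter_upwards [hae] with u hu
    exact prod_norm M _ (fun j => hM j _ (hu.1 j)) x
  have hTint : Integrable (fun u => Tprod T u x - x) μ := by
    obtain ⟨K, hK⟩ := prod_sub (X := X) M n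
    set C : ℝ := ∑ j, (M * ‖y j‖ + (M + 1) * ‖x‖) with hC
    refine Integrable.mono' (((hwint 1 one_pos).const_mul C).const_mul K)
      (hmeas.sub aestronglyMeasurable_const) ?_
    filter_upwards [hae] with u hu
    refine hK _ (fun j => hM j _ (hu.1 j)) x _ (fun j => ?_)
    have hM0 : 0 ≤ M := (norm_nonneg _).trans (hM j 0 le_rfl)
    refine (orbit_bd (T j) M (hT j) (hM j) x (y j) (hy j) (u j) (hu.1 j)).trans ?_
    have h1 : u j ≤ 1 * ∑ j, u j := by
      rw [one_mul]
      exact Finset.single_le_sum (fun i _ => hu.1 i) (Finset.mem_univ j)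
    have h2 : M * ‖y j‖ + (M + 1) * ‖x‖ ≤ C :=
      Finset.single_le_sum (f := fun j => M * ‖y j‖ + (M + 1) * ‖x‖)
        (fun i _ => by positivity) (Finset.mem_univ j)
    have h3 : 0 ≤ 1 - Real.exp (-u j) := by
      have := Real.exp_le_one_iff.2 (neg_nonpos.2 (hu.1 j)); linarith
    have h4 : 0 ≤ C := le_trans (by positivity) h2
    gcongr
  have hwnn : ∀ ε : ℝ, 0 < ε → ∀ᵐ u ∂μ, 0 ≤ 1 - Real.exp (-(ε * ∑ j, u j)) := by
    intro ε hε
    filter_upwards [hae] with u hu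
    have : 0 ≤ ε * ∑ j, u j := mul_nonneg hε.le (Finset.sum_nonneg fun j _ => hu.1 j)
    have := Real.exp_le_one_iff.2 (neg_nonpos.2 this); linarith
  have hbd : ∀ ε : ℝ, 0 < ε → ∀ᵐ u ∂μ, ‖(1 - Real.exp (-(ε * ∑ j, u j))) • Tprod T u x‖ ≤
      (1 - Real.exp (-(ε * ∑ j, u j))) * (M ^ n * ‖x‖) := by
    intro ε hε
    filter_upwards [hTb, hwnn ε hε] with u h1 h2
    rw [norm_smul, Real.norm_of_nonneg h2]
    gcongr
  have hdiff : ∀ ε : ℝ, 0 < ε →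
      (c₀ • x + (∑ j, c₁ j • y j) + ∫ u, (Tprod T u x - x) ∂μ) -
          (c₀ • x + (∑ j, c₁ j • (y j - ε • x)) +
            ∫ u, (Real.exp (-(ε * ∑ j, u j)) • Tprod T u x - x) ∂μ)
      = (ε * ∑ j, c₁ j) • x + ∫ u, (1 - Real.exp (-(ε * ∑ j, u j))) • Tprod T u x ∂μ := by
    intro ε hε
    have hI : Integrable (fun u => (1 - Real.exp (-(ε * ∑ j, u j))) • Tprod T u x) μ :=
      Integrable.mono' ((hwint ε hε).mul_const (M ^ n * ‖x‖))
        ((hwint ε hε).aestronglyMeasurable.smul hmeas) (hbd ε hε)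
    have h1 : ∫ u, (Real.exp (-(ε * ∑ j, u j)) • Tprod T u x - x) ∂μ =
        ∫ u, (Tprod T u x - x) ∂μ - ∫ u, (1 - Real.exp (-(ε * ∑ j, u j))) • Tprod T u x ∂μ := by
      rw [← integral_sub hTint hI]
      congr 1; ext u
      rw [sub_smul, one_smul]; abel
    have h2 : ∑ j, c₁ j • (y j - ε • x) = ∑ j, c₁ j • y j - (ε * ∑ j, c₁ j) • x := by
      simp only [smul_sub, Finset.sum_sub_distrib, smul_smul]
      rw [← Finset.sum_smul, Finset.mul_sum]
      simp only [mul_comm]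
    rw [h1, h2]; abel
  have hmain : ∀ ε : ℝ, 0 < ε →
      ‖(c₀ • x + (∑ j, c₁ j • y j) + ∫ u, (Tprod T u x - x) ∂μ) -
          (c₀ • x + (∑ j, c₁ j • (y j - ε • x)) +
            ∫ u, (Real.exp (-(ε * ∑ j, u j)) • Tprod T u x - x) ∂μ)‖ ≤
        (ε * ∑ j, c₁ j + M ^ n * ∫ u, (1 - Real.exp (-(ε * ∑ j, u j))) ∂μ) * ‖x‖ := by
    intro ε hε
    rw [hdiff ε hε]
    have h1 := norm_integral_le_of_norm_le ((hwint ε hε).mul_const (M ^ n * ‖x‖)) (hbd ε hε)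
    rw [integral_mul_const] at h1
    have h2 : 0 ≤ ε * ∑ j, c₁ j := mul_nonneg hε.le (Finset.sum_nonneg fun j _ => hc1 j)
    refine (norm_add_le _ _).trans ?_
    rw [norm_smul, Real.norm_of_nonneg h2]
    linarith
  refine ⟨fun ε hε => (hmain ε hε).trans ?_, ?_⟩
  · have h0 := integral_nonneg_of_ae (hwnn ε hε)
    have h1 := hψε ε hε
    have h2 := le_abs_self (c₀ - ψ (fun _ => -ε))
    gcongr ?_ * ‖x‖
    linarith
  · have hw0 : Tendsto (fun ε : ℝ => ∫ u : Fin n → ℝ, (1 - Real.exp (-(ε * ∑ j, u j))) ∂μ)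
        (𝓝[>] (0 : ℝ)) (𝓝 0) := by
      have hlt : ∀ᶠ ε : ℝ in 𝓝[>] (0 : ℝ), 0 < ε ∧ ε < 1 := Ioo_mem_nhdsGT one_pos
      have := tendsto_integral_filter_of_dominated_convergence (μ := μ) (l := 𝓝[>] (0 : ℝ))
        (F := fun ε u => 1 - Real.exp (-(ε * ∑ j, u j))) (f := fun _ => (0 : ℝ))
        (fun u : Fin n → ℝ => 1 - Real.exp (-(1 * ∑ j, u j)))
        (by filter_upwards [hlt] with ε hε using (hwint ε hε.1).aestronglyMeasurable)
        (by
          filter_upwards [hlt] with ε hε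
          filter_upwards [hae, hwnn ε hε.1] with u hu h
          rw [Real.norm_of_nonneg h]
          have : 0 ≤ ∑ j, u j := Finset.sum_nonneg fun j _ => hu.1 j
          have h3 := hε.2.le
          gcongr)
        (hwint 1 one_pos)
        (Eventually.of_forall fun u => by
          have : Continuous fun ε : ℝ => 1 - Real.exp (-(ε * ∑ j, u j)) := by fun_prop
          have h := this.tendsto 0
          simp only [zero_mul, neg_zero, Real.exp_zero, sub_self] at h
          exact h.mono_left nhdsWithin_le_nhds)
      simpa using this
    have hid : Tendsto (fun ε : ℝ => ε * ∑ j, c₁ j) (𝓝[>] (0 : ℝ)) (𝓝 0) := by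
      have : Continuous fun ε : ℝ => ε * ∑ j, c₁ j := by fun_prop
      have h := this.tendsto 0
      simp only [zero_mul] at h
      exact h.mono_left nhdsWithin_le_nhds
    have hlim := (hid.add (hw0.const_mul (M ^ n))).mul_const ‖x‖
    simp only [mul_zero, add_zero, zero_mul] at hlim
    rw [tendsto_iff_norm_sub_tendsto_zero]
    refine squeeze_zero' (Eventually.of_forall fun t => norm_nonneg _) ?_ hlim
    filter_upwards [self_mem_nhdsWithin] with ε hε
    rw [norm_sub_rev]
    exact hmain ε hε
end
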